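/- Assume in addition that σ′ and H′ are Lipschitz continuous. For every c > 0 there exists a constant C < ∞ such that for all 0 < t ≤ c and all x, y ∈ ℝ: |(∂²/∂x∂y + ∂²/∂x²) p̂(t, x, y)| ≤ C (p̂(t, x, y)/√t) (1 + w + w² + w³), where w = |S(y) − S(x)|/√t. -/

import Mathlib

open Real MeasureTheory intervalIntegral

/-- `S(x) = ∫₀^x σ(u)⁻¹ du`. -/
noncomputable def Sfun (σ : ℝ → ℝ) (x : ℝ) : ℝ := ∫ u in (0 : ℝ)..x, (σ u)⁻¹

/-- `C(u) = m(u)/σ(u) − σ′(u)/2`. -/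
noncomputable def Cfun (m σ : ℝ → ℝ) (u : ℝ) : ℝ := m u / σ u - deriv σ u / 2

/-- `H(x) = ∫₀^{S(x)} C(u) du`. -/
noncomputable def Hfun (m σ : ℝ → ℝ) (x : ℝ) : ℝ := ∫ u in (0 : ℝ)..(Sfun σ x), Cfun m σ u

/-- `p̂(t, x, y) = (2π t)^{−1/2} σ(y)⁻¹ exp(−(S(y) − S(x))²/(2t) + H(y) − H(x))`. -/
noncomputable def phat (m σ : ℝ → ℝ) (t x y : ℝ) : ℝ :=
  (2 * Real.pi * t) ^ (-(1 : ℝ) / 2) * (σ y)⁻¹ *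
    Real.exp (-(Sfun σ y - Sfun σ x) ^ 2 / (2 * t) + Hfun m σ y - Hfun m σ x)

theorem hasDerivAt_Sfun {σ : ℝ → ℝ} (hσ : Continuous σ) (h0 : ∀ x, σ x ≠ 0) (x : ℝ) :
    HasDerivAt (Sfun σ) (σ x)⁻¹ x :=
  ((hσ.inv₀ h0).integral_hasStrictDerivAt 0 x).hasDerivAt

theorem differentiable_Cfun {m σ : ℝ → ℝ} (hm : Differentiable ℝ m) (hσ : ContDiff ℝ 2 σ)
    (h0 : ∀ x, σ x ≠ 0) : Differentiable ℝ (Cfun m σ) :=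
  (hm.div (hσ.differentiable (by norm_num)) h0).sub (hσ.differentiable_deriv_two.div_const 2)

theorem hasDerivAt_Hfun {m σ : ℝ → ℝ} (hm : Differentiable ℝ m) (hσ : ContDiff ℝ 2 σ)
    (h0 : ∀ x, σ x ≠ 0) (x : ℝ) :
    HasDerivAt (Hfun m σ) (Cfun m σ (Sfun σ x) * (σ x)⁻¹) x := by
  have h := ((differentiable_Cfun hm hσ h0).continuous.integral_hasStrictDerivAt 0
    (Sfun σ x)).hasDerivAt
  exact h.comp x (hasDerivAt_Sfun hσ.continuous h0 x)

theorem differentiable_deriv_Hfun {m σ : ℝ → ℝ} (hm : Differentiable ℝ m) (hσ : ContDiff ℝ 2 σ)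
    (h0 : ∀ x, σ x ≠ 0) : Differentiable ℝ (deriv (Hfun m σ)) := by
  have hd : deriv (Hfun m σ) = fun x => Cfun m σ (Sfun σ x) * (σ x)⁻¹ :=
    funext fun x => (hasDerivAt_Hfun hm hσ h0 x).deriv
  have hS : Differentiable ℝ (Sfun σ) := fun x =>
    (hasDerivAt_Sfun hσ.continuous h0 x).differentiableAt
  rw [hd]
  exact ((differentiable_Cfun hm hσ h0).comp hS).mul
    ((hσ.differentiable (by norm_num)).inv h0)

theorem hasDerivAt_phat_left {m σ : ℝ → ℝ} (hσ : Continuous σ) (h0 : ∀ x, σ x ≠ 0)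
    (hH : Differentiable ℝ (Hfun m σ)) (t x y : ℝ) :
    HasDerivAt (fun x' => phat m σ t x' y)
      (phat m σ t x y * ((Sfun σ y - Sfun σ x) / t * (σ x)⁻¹ - deriv (Hfun m σ) x)) x := by
  have h := ((((((hasDerivAt_Sfun hσ h0 x).const_sub (Sfun σ y)).pow 2).neg.div_const
    (2 * t)).add_const (Hfun m σ y)).sub (hH x).hasDerivAt).exp.const_mul
      ((2 * Real.pi * t) ^ (-(1 : ℝ) / 2) * (σ y)⁻¹)
  refine h.congr_deriv ?_
  simp only [phat, Pi.pow_apply, Pi.neg_apply, Pi.sub_apply]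
  ring

theorem hasDerivAt_phat_right {m σ : ℝ → ℝ} (hσ : Differentiable ℝ σ) (h0 : ∀ x, σ x ≠ 0)
    (hH : Differentiable ℝ (Hfun m σ)) (t x y : ℝ) :
    HasDerivAt (fun y' => phat m σ t x y')
      (phat m σ t x y * (-deriv σ y * (σ y)⁻¹ - (Sfun σ y - Sfun σ x) / t * (σ y)⁻¹
        + deriv (Hfun m σ) y)) y := by
  have h := (((hσ y).hasDerivAt.inv (h0 y)).const_mul
    ((2 * Real.pi * t) ^ (-(1 : ℝ) / 2))).mul
    (((((((hasDerivAt_Sfun hσ.continuous h0 y).sub_const (Sfun σ x)).pow 2).neg.div_const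
    (2 * t)).add (hH y).hasDerivAt).sub_const (Hfun m σ x)).exp)
  refine h.congr_deriv ?_
  simp only [phat, Pi.pow_apply, Pi.neg_apply, Pi.add_apply, Pi.inv_apply]
  ring

theorem deriv_phat_mixed {m σ : ℝ → ℝ} (hσ : Differentiable ℝ σ) (h0 : ∀ x, σ x ≠ 0)
    (hH : Differentiable ℝ (Hfun m σ)) (t x y : ℝ) :
    deriv (fun x' => deriv (fun y' => phat m σ t x' y') y) x =
      phat m σ t x y * (((Sfun σ y - Sfun σ x) / t * (σ x)⁻¹ - deriv (Hfun m σ) x) *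
        (-deriv σ y * (σ y)⁻¹ - (Sfun σ y - Sfun σ x) / t * (σ y)⁻¹ + deriv (Hfun m σ) y)
        + (σ x)⁻¹ * (σ y)⁻¹ / t) := by
  simp only [fun x' => (hasDerivAt_phat_right hσ h0 hH t x' y).deriv]
  have h := (hasDerivAt_phat_left hσ.continuous h0 hH t x y).mul
    ((((((hasDerivAt_Sfun hσ.continuous h0 x).const_sub (Sfun σ y)).div_const t).mul_const
      (σ y)⁻¹).const_sub (-deriv σ y * (σ y)⁻¹)).add_const (deriv (Hfun m σ) y))
  refine h.deriv.trans ?_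
  ring

theorem iteratedDeriv_two_phat_left {m σ : ℝ → ℝ} (hσ : Differentiable ℝ σ) (h0 : ∀ x, σ x ≠ 0)
    (hH : Differentiable ℝ (Hfun m σ)) (hH' : Differentiable ℝ (deriv (Hfun m σ))) (t x y : ℝ) :
    iteratedDeriv 2 (fun x' => phat m σ t x' y) x =
      phat m σ t x y * (((Sfun σ y - Sfun σ x) / t * (σ x)⁻¹ - deriv (Hfun m σ) x) ^ 2
        - (σ x)⁻¹ ^ 2 / t - (Sfun σ y - Sfun σ x) / t * (deriv σ x * (σ x)⁻¹ ^ 2)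
        - deriv (deriv (Hfun m σ)) x) := by
  rw [iteratedDeriv_succ, iteratedDeriv_one]
  simp only [funext fun x' => (hasDerivAt_phat_left hσ.continuous h0 hH t x' y).deriv]
  have h := (hasDerivAt_phat_left hσ.continuous h0 hH t x y).mul
    (((((hasDerivAt_Sfun hσ.continuous h0 x).const_sub (Sfun σ y)).div_const t).mul
      ((hσ x).hasDerivAt.inv (h0 x))).sub (hH' x).hasDerivAt)
  refine h.deriv.trans ?_
  simp only [Pi.inv_apply, Pi.sub_apply, Pi.mul_apply]
  ring

theorem abs_sub_le_mul_abs_Sfun_sub {σ : ℝ → ℝ} {σu : ℝ} (hσ : Continuous σ)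
    (hpos : ∀ x, 0 < σ x) (hu : ∀ x, σ x ≤ σu) (x y : ℝ) :
    |y - x| ≤ σu * |Sfun σ y - Sfun σ x| := by
  have hu0 : 0 < σu := (hpos 0).trans_le (hu 0)
  have hS := hasDerivAt_Sfun hσ fun x => (hpos x).ne'
  have key : ∀ a b : ℝ, a ≤ b → b - a ≤ σu * (Sfun σ b - Sfun σ a) := fun a b hab => by
    have h := mul_sub_le_image_sub_of_le_deriv (C := σu⁻¹)
      (fun z => (hS z).differentiableAt) (fun z => by
        rw [(hS z).deriv]
        exact inv_anti₀ (hpos z) (hu z)) hab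
    rwa [inv_mul_le_iff₀ hu0] at h
  rcases le_total x y with h | h
  · rw [abs_of_nonneg (sub_nonneg.2 h)]
    exact (key x y h).trans (mul_le_mul_of_nonneg_left (le_abs_self _) hu0.le)
  · rw [abs_sub_comm, abs_of_nonneg (sub_nonneg.2 h), abs_sub_comm (Sfun σ y)]
    exact (key y x h).trans (mul_le_mul_of_nonneg_left (le_abs_self _) hu0.le)

theorem abs_inv_sub_inv_le {a b l : ℝ} (hl : 0 < l) (ha : l ≤ a) (hb : l ≤ b) :
    |a⁻¹ - b⁻¹| ≤ (l⁻¹) ^ 2 * |b - a| := by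
  have ha0 := hl.trans_le ha
  have hb0 := hl.trans_le hb
  have h : a⁻¹ - b⁻¹ = (a⁻¹ * b⁻¹) * (b - a) := by field_simp
  rw [h, abs_mul, abs_of_pos (by positivity), sq]
  gcongr

theorem abs_le_cubic_of_bounds {k D B L E R r w d a b p q h h' e : ℝ} (hr : 0 < r) (hrR : r ≤ R)
    (hw : w = |d| / r) (ha : |a| ≤ k) (hb : |b| ≤ k) (hp : |p| ≤ D) (hq : |q| ≤ D)
    (hh : |h| ≤ B) (hh' : |h'| ≤ B) (he : |e| ≤ L) (hE : |a - b| ≤ E * |d|) (hE0 : 0 ≤ E) :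
    |((d / r ^ 2 * a - h) * (-q * b - d / r ^ 2 * b + h') + a * b / r ^ 2) +
      ((d / r ^ 2 * a - h) ^ 2 - a ^ 2 / r ^ 2 - d / r ^ 2 * (p * a ^ 2) - e)| ≤
    ((k + B * R) * (D * k + E + 2 * B) + (k * E + D * k ^ 2 + L * R)) / r *
      (1 + w + w ^ 2 + w ^ 3) := by
  have hw0 : 0 ≤ w := hw ▸ by positivity
  have hk0 := (abs_nonneg a).trans ha
  have hD0 := (abs_nonneg p).trans hp
  have hB0 := (abs_nonneg h).trans hh
  have hL0 := (abs_nonneg e).trans he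
  have hd : |d| = w * r := by rw [hw]; field_simp
  have hdr : |d / r ^ 2| = w / r := by
    rw [abs_div, abs_of_pos (by positivity : 0 < r ^ 2), hd]; field_simp
  have h1 : |d / r ^ 2 * a - h| ≤ (k + B * R) / r * (1 + w) := by
    calc |d / r ^ 2 * a - h| ≤ |d / r ^ 2| * |a| + |h| := by
          rw [← abs_mul]; exact abs_sub _ _
      _ ≤ w / r * k + B := by rw [hdr]; gcongr
      _ = (w * k + B * r) / r := by field_simp
      _ ≤ (w * k + B * R) / r := by gcongr
      _ ≤ ((k + B * R) * (1 + w)) / r := by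
          have : 0 ≤ B * R := mul_nonneg hB0 (hr.le.trans hrR)
          gcongr
          nlinarith [mul_nonneg this hw0]
      _ = _ := by ring
  have h2 : |-q * b + d / r ^ 2 * (a - b) + h' - h| ≤ (D * k + E + 2 * B) * (1 + w ^ 2) := by
    calc |-q * b + d / r ^ 2 * (a - b) + h' - h|
        ≤ |-q * b| + |d / r ^ 2 * (a - b)| + |h'| + |h| :=
          (abs_sub _ _).trans (by gcongr; exact abs_add_three _ _ _)
      _ = |q| * |b| + |d / r ^ 2| * |a - b| + |h'| + |h| := by rw [abs_mul, abs_mul, abs_neg]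
      _ ≤ D * k + w / r * (E * (w * r)) + B + B := by rw [hdr, ← hd]; gcongr
      _ = D * k + E * w ^ 2 + 2 * B := by field_simp; ring
      _ ≤ _ := by nlinarith [mul_nonneg (mul_nonneg hD0 hk0) (sq_nonneg w),
          mul_nonneg hB0 (sq_nonneg w)]
  have h3 : |a * (b - a) / r ^ 2 - d / r ^ 2 * (p * a ^ 2) - e| ≤
      (k * E + D * k ^ 2 + L * R) / r * (1 + w) := by
    calc |a * (b - a) / r ^ 2 - d / r ^ 2 * (p * a ^ 2) - e|
        ≤ |a * (b - a) / r ^ 2| + |d / r ^ 2 * (p * a ^ 2)| + |e| :=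
          (abs_sub _ _).trans (by gcongr; exact abs_sub _ _)
      _ = |a| * |a - b| / r ^ 2 + |d / r ^ 2| * (|p| * |a| ^ 2) + |e| := by
          rw [abs_div, abs_of_pos (by positivity : 0 < r ^ 2), abs_mul, abs_mul, abs_mul, abs_pow,
            abs_sub_comm b a]
      _ ≤ k * (E * (w * r)) / r ^ 2 + w / r * (D * k ^ 2) + L := by rw [hdr, ← hd]; gcongr
      _ = ((k * E + D * k ^ 2) * w + L * r) / r := by field_simp
      _ ≤ ((k * E + D * k ^ 2) * w + L * R) / r := by gcongr
      _ ≤ ((k * E + D * k ^ 2 + L * R) * (1 + w)) / r := by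
          have : 0 ≤ L * R := mul_nonneg hL0 (hr.le.trans hrR)
          gcongr
          nlinarith [mul_nonneg this hw0, mul_nonneg hk0 hE0, mul_nonneg hD0 (sq_nonneg k)]
      _ = _ := by ring
  have hR0 : 0 ≤ R := hr.le.trans hrR
  calc _ = |(d / r ^ 2 * a - h) * (-q * b + d / r ^ 2 * (a - b) + h' - h) +
        (a * (b - a) / r ^ 2 - d / r ^ 2 * (p * a ^ 2) - e)| := by congr 1; ring
    _ ≤ |d / r ^ 2 * a - h| * |-q * b + d / r ^ 2 * (a - b) + h' - h| +
        |a * (b - a) / r ^ 2 - d / r ^ 2 * (p * a ^ 2) - e| := by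
          rw [← abs_mul]; exact abs_add_le _ _
    _ ≤ (k + B * R) / r * (1 + w) * ((D * k + E + 2 * B) * (1 + w ^ 2)) +
        (k * E + D * k ^ 2 + L * R) / r * (1 + w + w ^ 2 + w ^ 3) := by
          gcongr
          refine h3.trans (mul_le_mul_of_nonneg_left ?_ (by positivity))
          nlinarith [pow_nonneg hw0 2, pow_nonneg hw0 3]
    _ = _ := by ring

/-- Assume in addition that `σ′` and `H′` are Lipschitz continuous. For
every `c > 0` there exists a constant `C < ∞` such that for all `0 < t ≤ c` and all
`x, y ∈ ℝ`: `|(∂²/∂x∂y + ∂²/∂x²) p̂(t,x,y)| ≤ C (p̂(t,x,y)/√t)(1 + w + w² + w³)`,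
where `w = |S(y) − S(x)|/√t`. -/
theorem phat_mixed_plus_xx_deriv_bound
    (m σ : ℝ → ℝ) (hm : ContDiff ℝ 2 m) (hσ : ContDiff ℝ 2 σ)
    (M : ℝ)
    (hmbd : ∀ x, |m x| ≤ M ∧ |deriv m x| ≤ M ∧ |iteratedDeriv 2 m x| ≤ M)
    (hσbd : ∀ x, |σ x| ≤ M ∧ |deriv σ x| ≤ M ∧ |iteratedDeriv 2 σ x| ≤ M)
    (σl σu : ℝ) (hσl : 0 < σl) (hσrange : ∀ x, σl ≤ σ x ∧ σ x ≤ σu)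
    (L : NNReal) (hσ'lip : LipschitzWith L (deriv σ))
    (hH'lip : LipschitzWith L (deriv (Hfun m σ)))
    (c : ℝ) (hc : 0 < c) :
    ∃ C : ℝ, ∀ t : ℝ, 0 < t → t ≤ c → ∀ x y : ℝ,
      |deriv (fun x' => deriv (fun y' => phat m σ t x' y') y) x +
          iteratedDeriv 2 (fun x' => phat m σ t x' y) x| ≤
        C * (phat m σ t x y / Real.sqrt t) *
          (1 + |Sfun σ y - Sfun σ x| / Real.sqrt t +
            (|Sfun σ y - Sfun σ x| / Real.sqrt t) ^ 2 +
            (|Sfun σ y - Sfun σ x| / Real.sqrt t) ^ 3) := by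
  have hpos : ∀ x, 0 < σ x := fun x => hσl.trans_le (hσrange x).1
  have h0 : ∀ x, σ x ≠ 0 := fun x => (hpos x).ne'
  have hdm : Differentiable ℝ m := hm.differentiable (by norm_num)
  have hdσ : Differentiable ℝ σ := hσ.differentiable (by norm_num)
  have hH : Differentiable ℝ (Hfun m σ) := fun x => (hasDerivAt_Hfun hdm hσ h0 x).differentiableAt
  have hH' := differentiable_deriv_Hfun hdm hσ h0
  have hM0 : 0 ≤ M := (abs_nonneg _).trans (hσbd 0).1
  have hσu0 : 0 < σu := (hpos 0).trans_le (hσrange 0).2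
  have hinv : ∀ x, |(σ x)⁻¹| ≤ σl⁻¹ := fun x => by
    rw [abs_of_pos (inv_pos.2 (hpos x))]
    exact inv_anti₀ hσl (hσrange x).1
  have hHbd : ∀ x, |deriv (Hfun m σ) x| ≤ (M * σl⁻¹ + M / 2) * σl⁻¹ := fun x => by
    rw [(hasDerivAt_Hfun hdm hσ h0 x).deriv, abs_mul]
    refine mul_le_mul ?_ (hinv x) (abs_nonneg _) (by positivity)
    rw [Cfun, div_eq_mul_inv (m _)]
    refine (abs_sub _ _).trans (add_le_add ?_ ?_)
    · rw [abs_mul]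
      exact mul_le_mul (hmbd _).1 (hinv _) (abs_nonneg _) hM0
    · rw [abs_div, abs_two]
      gcongr
      exact (hσbd _).2.1
  have hH'bd : ∀ x, |deriv (deriv (Hfun m σ)) x| ≤ L := fun x =>
    norm_deriv_le_of_lipschitz hH'lip
  have hE : ∀ x y, |(σ x)⁻¹ - (σ y)⁻¹| ≤
      (σl⁻¹ ^ 2 * (M * σu)) * |Sfun σ y - Sfun σ x| := fun x y => by
    have hlip : |σ y - σ x| ≤ M * |y - x| :=
      Convex.norm_image_sub_le_of_norm_deriv_le (fun z _ => hdσ z) (fun z _ => (hσbd z).2.1)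
        convex_univ (Set.mem_univ x) (Set.mem_univ y)
    calc |(σ x)⁻¹ - (σ y)⁻¹| ≤ σl⁻¹ ^ 2 * |σ y - σ x| :=
          abs_inv_sub_inv_le hσl (hσrange x).1 (hσrange y).1
      _ ≤ σl⁻¹ ^ 2 * (M * (σu * |Sfun σ y - Sfun σ x|)) := by
          gcongr
          exact hlip.trans (mul_le_mul_of_nonneg_left (abs_sub_le_mul_abs_Sfun_sub hσ.continuous
            hpos (fun z => (hσrange z).2) x y) hM0)
      _ = _ := by ring
  have hE0 : 0 ≤ σl⁻¹ ^ 2 * (M * σu) := by positivity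
  generalize (M * σl⁻¹ + M / 2) * σl⁻¹ = B at hHbd
  generalize σl⁻¹ ^ 2 * (M * σu) = E at hE hE0
  generalize σl⁻¹ = k at hinv
  refine ⟨(k + B * √c) * (M * k + E + 2 * B) + (k * E + M * k ^ 2 + L * √c),
    fun t ht htc x y => ?_⟩
  have hbound := abs_le_cubic_of_bounds (Real.sqrt_pos.2 ht) (Real.sqrt_le_sqrt htc) rfl
    (hinv x) (hinv y) (hσbd x).2.1 (hσbd y).2.1 (hHbd x) (hHbd y) (hH'bd x) (hE x y) hE0
  rw [Real.sq_sqrt ht.le] at hbound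
  have hp : 0 ≤ phat m σ t x y := by
    have := hpos y
    unfold phat
    positivity
  rw [deriv_phat_mixed hdσ h0 hH, iteratedDeriv_two_phat_left hdσ h0 hH hH', ← mul_add, abs_mul,
    abs_of_nonneg hp]
  refine (mul_le_mul_of_nonneg_left hbound hp).trans_eq ?_
  ring
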